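/- Let Φᶜ(u) = ℙ(Z > u) denote the standard normal tail function. For every integer B > 5 with ln B ≥ 4 and every δ₃ ∈ (0, √2], one has (1 − Φᶜ(δ₃ √(ln B)))^{B−1} ≤ exp( − √2 · B^{1 − δ₃²/2} / (5 √(π ln B)) ). -/

import Mathlib

open MeasureTheory ProbabilityTheory Real Filter

noncomputable section

/-- The standard Gaussian measure on `ℝ`. -/
def stdGaussian : Measure ℝ := gaussianReal 0 1

/-- Standard normal tail function `Φᶜ(u) = ℙ(Z > u)`. -/
def PhiC (u : ℝ) : ℝ := (stdGaussian (Set.Ioi u)).toReal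

theorem tail_lower (u : ℝ) (hu : 0 < u) :
    (√(2 * π))⁻¹ * Real.exp (-u ^ 2 / 2) / (u + 1) ≤ PhiC u := by
  have hpdf : ∀ x, gaussianPDFReal 0 1 x = (√(2 * π))⁻¹ * Real.exp (-x ^ 2 / 2) := by
    intro x
    simp [gaussianPDFReal]
  have hP : PhiC u = ∫ x in Set.Ioi u, gaussianPDFReal 0 1 x := by
    unfold PhiC _root_.stdGaussian
    rw [gaussianReal_apply_eq_integral 0 (by norm_num)]
    exact ENNReal.toReal_ofReal
      (integral_nonneg (fun x => gaussianPDFReal_nonneg 0 1 x))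
  set c : ℝ := (√(2 * π))⁻¹ with hc
  have hc0 : 0 < c := by positivity
  have hder : ∀ x ∈ Set.Ici u, HasDerivAt (fun x : ℝ => -(c * Real.exp (-x ^ 2 / 2) / (x + 1)))
      (c * Real.exp (-x ^ 2 / 2) * ((x ^ 2 + x + 1) / (x + 1) ^ 2)) x := by
    intro x hx
    have hx1 : x + 1 ≠ 0 := by
      have : u ≤ x := hx
      linarith
    have h1 : HasDerivAt (fun x : ℝ => -x ^ 2 / 2) (-x) x := by
      have := ((hasDerivAt_pow 2 x).neg).div_const 2
      refine this.congr_deriv ?_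
      norm_num
      try ring
    have h2 := ((h1.exp.const_mul c).div ((hasDerivAt_id x).add_const 1) hx1).neg
    refine h2.congr_deriv ?_
    simp only [id]
    field_simp
    ring
  have hpos : ∀ x ∈ Set.Ioi u,
      0 ≤ c * Real.exp (-x ^ 2 / 2) * ((x ^ 2 + x + 1) / (x + 1) ^ 2) := by
    intro x hx
    have : u < x := hx
    have : 0 < x := by linarith
    positivity
  have hlim : Tendsto (fun x : ℝ => -(c * Real.exp (-x ^ 2 / 2) / (x + 1))) atTop (nhds 0) := by
    have h0 : Tendsto (fun x : ℝ => c / (x + 1)) atTop (nhds 0) :=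
      Tendsto.const_div_atTop (tendsto_atTop_add_const_right _ 1 tendsto_id) c
    rw [← neg_zero]
    apply Tendsto.neg
    refine squeeze_zero' ?_ ?_ h0
    · filter_upwards [eventually_gt_atTop 0] with x hx
      positivity
    · filter_upwards [eventually_gt_atTop 0] with x hx
      have : Real.exp (-x ^ 2 / 2) ≤ 1 := Real.exp_le_one_iff.2 (by nlinarith [sq_nonneg x])
      gcongr
      nlinarith
  have hint := integrableOn_Ioi_deriv_of_nonneg' hder hpos hlim
  have hI := integral_Ioi_of_hasDerivAt_of_nonneg' hder hpos hlim
  rw [zero_sub, neg_neg] at hI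
  rw [hP, ← hI]
  refine setIntegral_mono_on hint (integrable_gaussianPDFReal 0 1).integrableOn
    measurableSet_Ioi ?_
  intro x hx
  have hux : u < x := hx
  rw [hpdf]
  have : (x ^ 2 + x + 1) / (x + 1) ^ 2 ≤ 1 := by
    rw [div_le_one (by nlinarith)]
    nlinarith
  have hp : 0 < c * Real.exp (-x ^ 2 / 2) := by positivity
  nlinarith

/-- for every integer `B > 5` with `ln B ≥ 4` and every
`δ₃ ∈ (0, √2]`,
`(1 − Φᶜ(δ₃√(ln B)))^{B−1} ≤ exp(−√2·B^{1−δ₃²/2}/(5√(π ln B)))`. -/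
theorem stmt12 (B : ℕ) (hB : 5 < B) (hlnB : 4 ≤ Real.log B)
    (δ3 : ℝ) (hδ3 : 0 < δ3) (hδ3' : δ3 ≤ Real.sqrt 2) :
    (1 - PhiC (δ3 * Real.sqrt (Real.log B))) ^ (B - 1) ≤
      Real.exp (-(Real.sqrt 2 * (B : ℝ) ^ (1 - δ3 ^ 2 / 2)) /
        (5 * Real.sqrt (Real.pi * Real.log B))) := by
  have hB' : (5 : ℝ) < B := by exact_mod_cast hB
  have hB0 : (0 : ℝ) < B := by linarith
  set L := Real.log B with hL
  set s := √L with hs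
  have hs2 : s ^ 2 = L := Real.sq_sqrt (by linarith)
  have hs0 : 2 ≤ s := by
    apply Real.le_sqrt_of_sq_le
    linarith
  have hu : 0 < δ3 * s := by positivity
  have ht := tail_lower _ hu
  have hP1 : PhiC (δ3 * s) ≤ 1 := by
    have : IsProbabilityMeasure _root_.stdGaussian := by
      unfold _root_.stdGaussian
      infer_instance
    exact measureReal_le_one
  have h1 : (1 - PhiC (δ3 * s)) ^ (B - 1) ≤ Real.exp (-PhiC (δ3 * s)) ^ (B - 1) := by
    apply pow_le_pow_left₀ (by linarith)
    exact Real.one_sub_le_exp_neg _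
  refine h1.trans ?_
  rw [← Real.exp_nat_mul, Nat.cast_sub (by omega), Nat.cast_one]
  apply Real.exp_le_exp.2
  rw [neg_div, mul_neg, neg_le_neg_iff]
  have hBp : (B : ℝ) ^ (1 - δ3 ^ 2 / 2) = B * Real.exp (-(δ3 * s) ^ 2 / 2) := by
    rw [Real.rpow_def_of_pos hB0, ← hL]
    have hBe : (B : ℝ) = Real.exp L := (Real.exp_log hB0).symm
    rw [hBe, ← Real.exp_add, mul_pow, hs2]
    congr 1
    ring
  rw [hBp]
  set E := Real.exp (-(δ3 * s) ^ 2 / 2) with hE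
  have hE0 : 0 < E := Real.exp_pos _
  have hsπ : √(π * L) = √π * s := Real.sqrt_mul pi_pos.le _
  have hs2π : √(2 * π) = √2 * √π := Real.sqrt_mul (by norm_num) _
  have hr2 : √2 ≤ 1.5 := Real.sqrt_le_iff.2 (by norm_num)
  have hr22 : √2 * √2 = 2 := Real.mul_self_sqrt (by norm_num)
  have hr20 : 0 < √2 := by positivity
  have hp0 : 0 < √π := by positivity
  rw [hs2π] at ht
  rw [hsπ]
  have hden : δ3 * s + 1 ≤ 2 * s := by nlinarith
  have ht2 : (√2 * √π)⁻¹ * E / (2 * s) ≤ PhiC (δ3 * s) := by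
    refine le_trans ?_ ht
    gcongr
  have hb1 : 4 / 5 * (B : ℝ) ≤ B - 1 := by linarith
  calc √2 * (B * E) / (5 * (√π * s)) = 4 / 5 * (B : ℝ) * ((√2 * √π)⁻¹ * E / (2 * s)) := by
        field_simp
        nlinarith
    _ ≤ _ := by
        apply mul_le_mul hb1 ht2 (by positivity) (by linarith)

end
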